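/- arXiv:2002.10780 — 5 statements merged into one kernel-verified Lean document; each statement's English description precedes it below -/
import Mathlib

section
/- Let 𝒞 be a finite color space partitioned into p ≥ 1 parts 𝒞₁,…,𝒞ₚ, and let L ⊆ 𝒞 be a finite set. Then there exists an integer k ∈ {1,…,p} and a set of indices I ⊆ {1,…,p} with |I| = k such that for all j ∈ I one has |L ∩ 𝒞ⱼ| ≥ |L| / (k · H_p). -/
/-- Some `k` of the `p` values of a real function are all at least `1 / (k * H_p)` times the total. -/
theorem exists_card_eq_forall_sum_div_mul_harmonic_le (p : ℕ) (hp : 1 ≤ p) (f : Fin p → ℝ) :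
    ∃ k : ℕ, 1 ≤ k ∧ k ≤ p ∧ ∃ I : Finset (Fin p), I.card = k ∧
      ∀ j ∈ I, (∑ i, f i) / (k * ∑ i ∈ Finset.Icc 1 p, (1 : ℝ) / i) ≤ f j := by
  by_contra! hlt
  set H : ℝ := ∑ i ∈ Finset.Icc 1 p, (1 : ℝ) / i with hH
  have hH_pos : 0 < H := by
    refine Finset.sum_pos (fun i hi => ?_) ⟨1, by simpa using hp⟩
    have : 0 < i := (Finset.mem_Icc.1 hi).1
    positivity
  have hH_fin : ∑ i : Fin p, (1 : ℝ) / ((i : ℕ) + 1 : ℕ) = H := by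
    rw [hH, Fin.sum_univ_eq_sum_range (fun i => (1 : ℝ) / (i + 1 : ℕ)) p,
      Finset.range_eq_Ico, Finset.sum_Ico_add' (fun i : ℕ => (1 : ℝ) / i)]
    rfl
  set σ := Tuple.sort (fun i => -f i)
  have hσ : Monotone ((fun i => -f i) ∘ σ) := Tuple.monotone_sort _
  have hbound (i : Fin p) : f (σ i) < (∑ i, f i) / (((i : ℕ) + 1 : ℕ) * H) := by
    obtain ⟨j, hj, hjlt⟩ := hlt (i + 1) (by omega) (by omega)
      ((Finset.Iic i).map σ.toEmbedding) (by simp)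
    obtain ⟨m, hm, rfl⟩ := Finset.mem_map.1 hj
    exact (neg_le_neg_iff.1 (hσ (Finset.mem_Iic.1 hm))).trans_lt hjlt
  have hsum : ∑ i, f (σ i) < ∑ i : Fin p, (∑ i, f i) / (((i : ℕ) + 1 : ℕ) * H) :=
    Finset.sum_lt_sum_of_nonempty ⟨⟨0, hp⟩, Finset.mem_univ _⟩ fun i _ => hbound i
  have htotal : ∑ i : Fin p, (∑ i, f i) / (((i : ℕ) + 1 : ℕ) * H) = ∑ i, f i := by
    calc
      _ = ∑ i : Fin p, (∑ i, f i) / H * (1 / ((i : ℕ) + 1 : ℕ)) :=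
        Finset.sum_congr rfl fun i _ => by field_simp
      _ = _ := by rw [← Finset.mul_sum, hH_fin, div_mul_cancel₀ _ hH_pos.ne']
  rw [htotal, Equiv.sum_comp σ f] at hsum
  exact hsum.false


/-- Let `𝒞` be a finite color space partitioned into `p ≥ 1` parts
`𝒞₁, …, 𝒞ₚ`, and let `L ⊆ 𝒞` be a finite set. Then there exist an integer
`k ∈ {1, …, p}` and a set of indices `I ⊆ {1, …, p}` with `|I| = k` such that for all
`j ∈ I` one has `|L ∩ 𝒞ⱼ| ≥ |L| / (k · H_p)`, where `H_p = ∑_{i=1}^p 1/i`. -/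
theorem large_intersection_subspaces {α : Type*} [DecidableEq α]
    (p : ℕ) (hp : 1 ≤ p) (𝒞 : Finset α) (C : Fin p → Finset α)
    (hdisj : ∀ i j : Fin p, i ≠ j → Disjoint (C i) (C j))
    (hunion : Finset.univ.biUnion C = 𝒞)
    (L : Finset α) (hL : L ⊆ 𝒞) :
    ∃ k : ℕ, 1 ≤ k ∧ k ≤ p ∧
      ∃ I : Finset (Fin p), I.card = k ∧
        ∀ j ∈ I, ((L ∩ C j).card : ℝ) ≥
          (L.card : ℝ) / (k * ∑ i ∈ Finset.Icc 1 p, (1 : ℝ) / i) := by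
  have hcard : (L.card : ℝ) = ∑ i, ((L ∩ C i).card : ℝ) := by
    rw [← Nat.cast_sum, ← Finset.card_biUnion, ← Finset.inter_biUnion, hunion,
      Finset.inter_eq_left.2 hL]
    exact fun i _ j _ hij =>
      (hdisj i j hij).mono Finset.inter_subset_right Finset.inter_subset_right
  rw [hcard]
  exact exists_card_eq_forall_sum_div_mul_harmonic_le p hp _
end

section
/- Let p ≥ 1 be an integer and let a₁ ≥ a₂ ≥ … ≥ a_p ≥ 0 be real numbers with total sum s = ∑_{i=1}^p a_i. Then there exists an index k ∈ {1,…,p} such that a_k ≥ s / (k · H_p). -/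
/-- Let `p ≥ 1` be an integer and let `a₁ ≥ a₂ ≥ … ≥ a_p ≥ 0` be real
numbers with total sum `s = ∑_{i=1}^p a_i`. Then there exists an index `k ∈ {1, …, p}`
such that `a_k ≥ s / (k · H_p)`, where `H_p = ∑_{i=1}^p 1/i`. -/
theorem sorted_seq_large_element (p : ℕ) (hp : 1 ≤ p) (a : ℕ → ℝ)
    (hmono : ∀ i j : ℕ, 1 ≤ i → i ≤ j → j ≤ p → a j ≤ a i)
    (hnonneg : ∀ i : ℕ, 1 ≤ i → i ≤ p → 0 ≤ a i)
    (s : ℝ) (hs : s = ∑ i ∈ Finset.Icc 1 p, a i) :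
    ∃ k : ℕ, 1 ≤ k ∧ k ≤ p ∧
      a k ≥ s / (k * ∑ i ∈ Finset.Icc 1 p, (1 : ℝ) / i) := by
  have hne : (Finset.Icc 1 p).Nonempty := ⟨1, Finset.mem_Icc.2 ⟨le_rfl, hp⟩⟩
  have hpos : ∀ i ∈ Finset.Icc 1 p, (0 : ℝ) < i := fun i hi =>
    Nat.cast_pos.2 (Finset.mem_Icc.1 hi).1
  have hH : 0 < ∑ i ∈ Finset.Icc 1 p, (1 : ℝ) / i :=
    Finset.sum_pos (fun i hi => one_div_pos.2 (hpos i hi)) hne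
  have hsum : ∑ i ∈ Finset.Icc 1 p, s / (i * ∑ j ∈ Finset.Icc 1 p, (1 : ℝ) / j) ≤
      ∑ i ∈ Finset.Icc 1 p, a i := by
    rw [← hs]
    set H := ∑ j ∈ Finset.Icc 1 p, (1 : ℝ) / j with hHdef
    have hterm : ∀ i ∈ Finset.Icc 1 p, s / (i * H) = s / H * (1 / i) := fun i _ => by
      rw [div_mul_div_comm, mul_one, mul_comm]
    rw [Finset.sum_congr rfl hterm, ← Finset.mul_sum, ← hHdef, div_mul_cancel₀ _ hH.ne']
  obtain ⟨k, hk, hle⟩ := Finset.exists_le_of_sum_le hne hsum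
  exact ⟨k, (Finset.mem_Icc.1 hk).1, (Finset.mem_Icc.1 hk).2, hle⟩
end

section
/- Let 𝒞 be a finite color space partitioned into q ≥ 1 parts 𝒞₁,…,𝒞_q, and let L ⊆ 𝒞 be a finite set. Then there exists an integer ℓ ∈ {0,…,⌊log₂ q⌋} and a set of indices I ⊆ {1,…,q} with |I| ≥ 2^ℓ such that for all i ∈ I one has |L ∩ 𝒞ᵢ| ≥ |L| / (2^{ℓ+1} · H_q). -/
theorem sum_Icc_one_div_pos {q : ℕ} (hq : 1 ≤ q) :
    0 < ∑ i ∈ Finset.Icc 1 q, (1 : ℝ) / i :=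
  Finset.sum_pos (fun i hi => by
    have : 0 < i := (Finset.mem_Icc.mp hi).1
    positivity) ⟨1, Finset.mem_Icc.mpr ⟨le_rfl, hq⟩⟩

/-- Among `q` reals with sum `S`, for some `j < q` there are `j + 1` of them that are at least
`S / ((j + 1) * H_q)`, where `H_q` is the `q`-th harmonic number. -/
theorem exists_card_eq_forall_sum_div_harmonic_le {q : ℕ} (hq : 1 ≤ q) (f : Fin q → ℝ) :
    ∃ j : Fin q, ∃ I : Finset (Fin q), I.card = (j : ℕ) + 1 ∧
      ∀ i ∈ I, (∑ i, f i) / (((j : ℕ) + 1) * ∑ i ∈ Finset.Icc 1 q, (1 : ℝ) / i) ≤ f i := by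
  set H : ℝ := ∑ i ∈ Finset.Icc 1 q, (1 : ℝ) / i with hH
  have hHpos : 0 < H := sum_Icc_one_div_pos hq
  have hHfin : ∑ j : Fin q, (1 : ℝ) / ((j : ℕ) + 1) = H := by
    rw [hH, Fin.sum_univ_eq_sum_range (fun j : ℕ => (1 : ℝ) / (j + 1)) q,
      Finset.range_eq_Ico, ← Finset.Ico_add_one_right_eq_Icc,
      ← Finset.sum_Ico_add' (fun j : ℕ => (1 : ℝ) / j) 0 q 1]
    simp
  set σ := Tuple.sort (fun i => -f i)
  have hσ : Monotone ((fun i => -f i) ∘ σ) := Tuple.monotone_sort _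
  have hne : (Finset.univ : Finset (Fin q)).Nonempty := ⟨⟨0, hq⟩, Finset.mem_univ _⟩
  obtain ⟨j, -, hj⟩ : ∃ j ∈ (Finset.univ : Finset (Fin q)),
      (∑ i, f i) / (((j : ℕ) + 1) * H) ≤ f (σ j) := by
    refine Finset.exists_le_of_sum_le hne (le_of_eq ?_)
    calc ∑ j : Fin q, (∑ i, f i) / (((j : ℕ) + 1) * H)
        = ∑ j : Fin q, (∑ i, f i) / H * (1 / ((j : ℕ) + 1)) := by
          refine Finset.sum_congr rfl fun j _ => ?_
          field_simp
      _ = ∑ i, f i := by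
          rw [← Finset.mul_sum, hHfin, div_mul_cancel₀ _ hHpos.ne']
      _ = ∑ j, f (σ j) := (Equiv.sum_comp σ f).symm
  refine ⟨j, (Finset.Iic j).map σ.toEmbedding, by simp, fun i hi => ?_⟩
  obtain ⟨k, hk, rfl⟩ := Finset.mem_map.mp hi
  exact hj.trans (neg_le_neg_iff.mp (hσ (Finset.mem_Iic.mp hk)))

/-- Let `𝒞` be a finite color space partitioned into `q ≥ 1` parts
`𝒞₁, …, 𝒞_q`, and let `L ⊆ 𝒞` be a finite set. Then there exist an integer
`ℓ ∈ {0, …, ⌊log₂ q⌋}` and a set of indices `I ⊆ {1, …, q}` with `|I| ≥ 2^ℓ` such that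
for all `i ∈ I` one has `|L ∩ 𝒞ᵢ| ≥ |L| / (2^(ℓ+1) · H_q)`,
where `H_q = ∑_{i=1}^q 1/i`. -/
theorem level_large_intersection_subspaces {α : Type*} [DecidableEq α]
    (q : ℕ) (hq : 1 ≤ q) (𝒞 : Finset α) (C : Fin q → Finset α)
    (hdisj : ∀ i j : Fin q, i ≠ j → Disjoint (C i) (C j))
    (hunion : Finset.univ.biUnion C = 𝒞)
    (L : Finset α) (hL : L ⊆ 𝒞) :
    ∃ ℓ : ℕ, ℓ ≤ Nat.log 2 q ∧
      ∃ I : Finset (Fin q), 2 ^ ℓ ≤ I.card ∧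
        ∀ i ∈ I, ((L ∩ C i).card : ℝ) ≥
          (L.card : ℝ) / (2 ^ (ℓ + 1) * ∑ i ∈ Finset.Icc 1 q, (1 : ℝ) / i) := by
  have hcard : (L.card : ℝ) = ∑ i, ((L ∩ C i).card : ℝ) := by
    have hL' : L = Finset.univ.biUnion fun i => L ∩ C i := by
      rw [← Finset.inter_biUnion, hunion, Finset.inter_eq_left.mpr hL]
    rw [← Nat.cast_sum, ← Finset.card_biUnion, ← hL']
    exact fun i _ j _ hij =>
      (hdisj i j hij).mono Finset.inter_subset_right Finset.inter_subset_right
  obtain ⟨j, I, hI, hle⟩ :=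
    exists_card_eq_forall_sum_div_harmonic_le hq fun i => ((L ∩ C i).card : ℝ)
  refine ⟨Nat.log 2 (j + 1), Nat.log_mono_right j.isLt, I, ?_, fun i hi => ?_⟩
  · rw [hI]
    exact Nat.pow_log_le_self 2 (Nat.succ_ne_zero _)
  · refine le_trans ?_ (hle i hi)
    rw [← hcard]
    have hlt : ((j : ℕ) + 1 : ℝ) ≤ 2 ^ (Nat.log 2 (j + 1) + 1) := by
      exact_mod_cast (Nat.lt_pow_succ_log_self one_lt_two ((j : ℕ) + 1)).le
    have hHpos : 0 < ∑ i ∈ Finset.Icc 1 q, (1 : ℝ) / i :=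
      sum_Icc_one_div_pos hq
    gcongr
end

section
/- For every finite simple graph G = (V,E) and every integer β ≥ 1, there exists an edge coloring g : E → K with a color set K of size |K| ≤ 6β(4β+1) such that every edge e ∈ E has at most deg(e)/(2β) neighboring edges f with g(f) = g(e). -/
open Finset in
/-- Splitting off the row and the column of `a` from a symmetric double sum that vanishes
at `(a, a)`. -/
theorem sum_sum_eq_add_two_mul_of_symm {W : Type*} [Fintype W] [DecidableEq W]
    (f : W → W → ℕ) (hsymm : ∀ x y, f x y = f y x) (a : W) (ha : f a a = 0) :
    ∑ x, ∑ y, f x y = (∑ x ∈ univ.erase a, ∑ y ∈ univ.erase a, f x y) + 2 * ∑ y, f a y := by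
  have hrow : ∀ x, ∑ y, f x y = f x a + ∑ y ∈ univ.erase a, f x y := fun x =>
    (add_sum_erase univ (f x) (mem_univ a)).symm
  rw [← add_sum_erase univ (fun x => ∑ y, f x y) (mem_univ a),
    sum_congr rfl fun x _ => hrow x, sum_add_distrib,
    sum_congr rfl fun x _ => hsymm x a, hrow a, ha]
  ring

open Finset in
/-- **Lovász's defective coloring.** The vertices of a finite graph can be colored with `k` colors
so that at most a `1 / k` fraction of the neighbors of each vertex share its color. -/
theorem SimpleGraph.exists_defective_coloring {W : Type*} [Fintype W] [DecidableEq W]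
    (H : SimpleGraph W) [DecidableRel H.Adj] (k : ℕ) [NeZero k] :
    ∃ c : W → Fin k, ∀ w, k * #{x | H.Adj w x ∧ c x = c w} ≤ H.degree w := by
  obtain ⟨c, hc⟩ := Finite.exists_min fun c : W → Fin k =>
    ∑ x, ∑ y, if H.Adj x y ∧ c y = c x then 1 else 0
  refine ⟨c, fun a => ?_⟩
  have hmin (j : Fin k) : #{x | H.Adj a x ∧ c x = c a} ≤ #{x | H.Adj a x ∧ c x = j} := by
    have hsplit (d : W → Fin k) := sum_sum_eq_add_two_mul_of_symm
      (fun x y => if H.Adj x y ∧ d y = d x then 1 else 0)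
      (fun x y => by simp only [H.adj_comm x y, eq_comm]) a (by simp)
    have h := hc (Function.update c a j)
    simp only [hsplit] at h
    have hrest : (∑ x ∈ univ.erase a, ∑ y ∈ univ.erase a, if H.Adj x y ∧
          Function.update c a j y = Function.update c a j x then 1 else 0) =
        ∑ x ∈ univ.erase a, ∑ y ∈ univ.erase a, if H.Adj x y ∧ c y = c x then 1 else 0 :=
      sum_congr rfl fun x hx => sum_congr rfl fun y hy => by
        rw [Function.update_of_ne (ne_of_mem_erase hx), Function.update_of_ne (ne_of_mem_erase hy)]
    have hrow : (∑ y, if H.Adj a y ∧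
          Function.update c a j y = Function.update c a j a then 1 else 0) =
        ∑ y, if H.Adj a y ∧ c y = j then 1 else 0 :=
      sum_congr rfl fun y _ => by
        rcases eq_or_ne y a with rfl | hy
        · simp
        · rw [Function.update_of_ne hy, Function.update_self]
    rw [hrest, hrow] at h
    rw [card_filter, card_filter]
    lia
  calc k * #{x | H.Adj a x ∧ c x = c a}
      = ∑ _j : Fin k, #{x | H.Adj a x ∧ c x = c a} := by simp
    _ ≤ ∑ j, #{x | H.Adj a x ∧ c x = j} := sum_le_sum fun j _ => hmin j
    _ = H.degree a := by
      rw [← H.card_neighborFinset_eq_degree, card_eq_sum_card_fiberwise (f := c) (t := univ)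
        fun _ _ => mem_coe.2 (mem_univ _), H.neighborFinset_eq_filter]
      simp only [filter_filter]

open Finset in
/-- The number of edges neighboring `{u, v}` is at most the edge degree of `{u, v}`. -/
theorem SimpleGraph.card_neighboring_edges_add_two_le {V : Type*} [Fintype V] [DecidableEq V]
    (G : SimpleGraph V) [DecidableRel G.Adj] {u v : V} (huv : G.Adj u v) :
    #{f ∈ G.edgeFinset | f ≠ s(u, v) ∧ (u ∈ f ∨ v ∈ f)} + 2 ≤ G.degree u + G.degree v := by
  have hsub : ({f ∈ G.edgeFinset | f ≠ s(u, v) ∧ (u ∈ f ∨ v ∈ f)} : Finset (Sym2 V)) ⊆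
      (G.incidenceFinset u).erase s(u, v) ∪ (G.incidenceFinset v).erase s(u, v) := by
    intro f hf
    simp only [mem_filter, mem_edgeFinset] at hf
    simp only [mem_union, mem_erase, mem_incidenceFinset, incidenceSet, Set.mem_ofPred_eq]
    tauto
  have hcard := (card_le_card hsub).trans (card_union_le _ _)
  have hu : s(u, v) ∈ G.incidenceFinset u := by simp [incidenceSet, huv]
  have hv : s(u, v) ∈ G.incidenceFinset v := by simp [incidenceSet, huv]
  have hu' := card_erase_add_one hu
  have hv' := card_erase_add_one hv
  rw [card_incidenceFinset_eq_degree] at hu' hv'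
  lia


/-- For every finite simple graph `G = (V,E)` and every integer
`β ≥ 1`, there exists an edge coloring `g : E → K` with a color set `K` of size
`|K| ≤ 6β(4β+1)` (here: colors are natural numbers `< 6β(4β+1)`) such that every edge
`e = {u,v} ∈ E` has at most `deg(e)/(2β)` neighboring edges `f` (distinct edges sharing
an endpoint with `e`) with `g(f) = g(e)`, where `deg(e) = deg(u) + deg(v) - 2`. -/
theorem exists_defective_edge_coloring {V : Type*} [Fintype V] [DecidableEq V]
    (G : SimpleGraph V) [DecidableRel G.Adj] (β : ℕ) (hβ : 1 ≤ β) :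
    ∃ g : Sym2 V → ℕ,
      (∀ e ∈ G.edgeSet, g e < 6 * β * (4 * β + 1)) ∧
      (∀ u v : V, G.Adj u v →
        (({f | f ∈ G.edgeSet ∧ f ≠ s(u, v) ∧ (u ∈ f ∨ v ∈ f) ∧ g f = g s(u, v)}.ncard : ℝ) ≤
          ((G.degree u : ℝ) + (G.degree v : ℝ) - 2) / (2 * (β : ℝ)))) := by
  classical
  have : NeZero (2 * β) := ⟨by lia⟩
  let H : SimpleGraph (Sym2 V) := SimpleGraph.fromRel fun e f =>
    e ∈ G.edgeSet ∧ f ∈ G.edgeSet ∧ ∃ w, w ∈ e ∧ w ∈ f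
  obtain ⟨c, hc⟩ := H.exists_defective_coloring (2 * β)
  refine ⟨fun e => c e, fun e _ => (c e).isLt.trans_le (by nlinarith), fun u v huv => ?_⟩
  have hadj (f : Sym2 V) : H.Adj s(u, v) f ↔
      f ∈ G.edgeSet ∧ f ≠ s(u, v) ∧ (u ∈ f ∨ v ∈ f) := by
    have he : s(u, v) ∈ G.edgeSet := huv
    simp only [H, SimpleGraph.fromRel_adj, Sym2.mem_iff, he, ne_comm (a := f)]
    grind
  have hset : {f | f ∈ G.edgeSet ∧ f ≠ s(u, v) ∧ (u ∈ f ∨ v ∈ f) ∧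
      (c f : ℕ) = (c s(u, v) : ℕ)} =
        (Finset.univ.filter fun f => H.Adj s(u, v) f ∧ c f = c s(u, v) : Finset (Sym2 V)) := by
    ext f
    simp [hadj, Fin.ext_iff, and_assoc]
  have hdeg : H.degree s(u, v) + 2 ≤ G.degree u + G.degree v := by
    convert G.card_neighboring_edges_add_two_le huv using 2
    rw [← H.card_neighborFinset_eq_degree]
    congr 1
    ext f
    simp [hadj]
  have hbound := (Nat.add_le_add_right (hc s(u, v)) 2).trans hdeg
  rw [hset, Set.ncard_coe_finset, le_div_iff₀ (by positivity), le_sub_iff_add_le, mul_comm]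
  exact_mod_cast hbound
end

section
/- Let G = (V,E) be a finite simple graph, let p ≥ 2 be an integer, and let 𝒞 be a finite color space partitioned into q parts 𝒞₁,…,𝒞_q with 1 ≤ q ≤ 2p. Suppose each edge e ∈ E is assigned a nonempty finite list L_e ⊆ 𝒞. Then there exists an assignment i : E → {1,…,q} of a color subspace to each edge such that for every edge e ∈ E: (a) L_e ∩ 𝒞_{i(e)} ≠ ∅, and (b) the number deg'(e) of neighboring edges f with i(f) = i(e) satisfies deg'(e) ≤ 24 · H_q · log₂ p · (|L_e ∩ 𝒞_{i(e)}| / |L_e|) · deg(e). -/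
/-- Lovász-type defective list coloring: if the defects `a v j` of the colors `j` in the list
`A v` sum to at least the degree of `v`, there is a list coloring in which every vertex `v` of
color `j` has at most `a v j` neighbors of its own color. -/
theorem SimpleGraph.exists_defective_list_coloring {β κ : Type*} [Fintype β] [DecidableEq β]
    [Finite κ] [DecidableEq κ] (H : SimpleGraph β) [DecidableRel H.Adj] (A : β → Finset κ)
    (hA : ∀ v, (A v).Nonempty) (a : β → κ → ℝ)
    (ha : ∀ v, (H.degree v : ℝ) ≤ ∑ j ∈ A v, a v j) :
    ∃ c : β → κ, ∀ v, c v ∈ A v ∧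
      (((H.neighborFinset v).filter (fun w => c w = c v)).card : ℝ) ≤ a v (c v) := by
  classical
  let f : (β → κ) → β → β → ℝ := fun c v w => if H.Adj v w ∧ c w = c v then 1 else 0
  let Φ : (β → κ) → ℝ := fun c => ∑ v, ∑ w, f c v w - 2 * ∑ v, a v (c v)
  have f_symm : ∀ c v w, f c v w = f c w v := fun c v w => by
    simp only [f, H.adj_comm v w, eq_comm (a := c w)]
  have f_self : ∀ c v, f c v v = 0 := fun c v => by simp [f]
  have f_split : ∀ c x, ∑ v, ∑ w, f c v w =
      2 * ∑ w, f c x w + ∑ v ∈ Finset.univ.erase x, ∑ w ∈ Finset.univ.erase x, f c v w := by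
    intro c x
    rw [← Finset.add_sum_erase _ _ (Finset.mem_univ x)]
    have h : ∀ v, ∑ w, f c v w = f c x v + ∑ w ∈ Finset.univ.erase x, f c v w := fun v => by
      rw [← Finset.add_sum_erase _ _ (Finset.mem_univ x), f_symm]
    have h' := h x
    rw [f_self, zero_add] at h'
    rw [Finset.sum_congr rfl (fun v _ => h v), Finset.sum_add_distrib, ← h']
    ring
  have hne : {c : β → κ | ∀ v, c v ∈ A v}.Nonempty :=
    ⟨fun v => (hA v).choose, fun v => (hA v).choose_spec⟩
  obtain ⟨c, hc, hmin⟩ := Set.exists_min_image _ Φ (Set.toFinite _) hne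
  refine ⟨c, fun x => ⟨hc x, ?_⟩⟩
  let N : κ → ℝ := fun j => (((H.neighborFinset x).filter (fun w => c w = j)).card : ℝ)
  have N_eq : ∀ j, ∑ w, f (Function.update c x j) x w = N j := by
    intro j
    simp only [f, N, Finset.sum_boole]
    congr 2
    ext w
    simp only [Finset.mem_filter, Finset.mem_univ, true_and, SimpleGraph.mem_neighborFinset,
      Function.update_self]
    refine and_congr_right fun h => ?_
    rw [Function.update_of_ne h.ne']
  have step : ∀ j ∈ A x, N (c x) - a x (c x) ≤ N j - a x j := by
    intro j hj
    have h := hmin (Function.update c x j) (fun v => by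
      by_cases hv : v = x
      · subst hv; simpa using hj
      · simpa [Function.update_of_ne hv] using hc v)
    have h0 := N_eq (c x)
    rw [Function.update_eq_self] at h0
    have hrest : ∑ v ∈ Finset.univ.erase x, ∑ w ∈ Finset.univ.erase x,
        f (Function.update c x j) v w =
        ∑ v ∈ Finset.univ.erase x, ∑ w ∈ Finset.univ.erase x, f c v w := by
      refine Finset.sum_congr rfl fun v hv => Finset.sum_congr rfl fun w hw => ?_
      simp only [f, Function.update_of_ne (Finset.ne_of_mem_erase hv),
        Function.update_of_ne (Finset.ne_of_mem_erase hw)]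
    have hdefect : ∑ v ∈ Finset.univ.erase x, a v (Function.update c x j v) =
        ∑ v ∈ Finset.univ.erase x, a v (c v) :=
      Finset.sum_congr rfl fun v hv => by rw [Function.update_of_ne (Finset.ne_of_mem_erase hv)]
    simp only [Φ] at h
    rw [f_split _ x, f_split (Function.update c x j) x, N_eq, h0, hrest,
      ← Finset.add_sum_erase _ (fun v => a v (c v)) (Finset.mem_univ x),
      ← Finset.add_sum_erase _ (fun v => a v (Function.update c x j v)) (Finset.mem_univ x),
      hdefect, Function.update_self] at h
    linarith
  have hN : ∑ j ∈ A x, N j ≤ ∑ j ∈ A x, a x j := by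
    refine le_trans ?_ (ha x)
    simp only [N]
    rw [← Nat.cast_sum, Nat.cast_le, Finset.sum_card_fiberwise_eq_card_filter]
    exact Finset.card_filter_le _ _
  obtain ⟨j, hj, hle⟩ := Finset.exists_le_of_sum_le (hA x) hN
  have := step j hj
  change N (c x) ≤ _
  linarith

/-- In the line graph, an edge `uv` has at most `deg u + deg v - 2` neighbors. -/
theorem SimpleGraph.degree_lineGraph_add_two_le {V : Type*} [Fintype V] [DecidableEq V]
    (G : SimpleGraph V) [DecidableRel G.Adj] {u v : V} (h : G.Adj u v)
    [Fintype (G.lineGraph.neighborSet ⟨s(u, v), h⟩)] :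
    G.lineGraph.degree ⟨s(u, v), h⟩ + 2 ≤ G.degree u + G.degree v := by
  have hu : s(u, v) ∈ G.incidenceFinset u :=
    (G.mem_incidenceFinset _ _).2 ⟨h, Sym2.mem_mk_left u v⟩
  have hv : s(u, v) ∈ G.incidenceFinset v :=
    (G.mem_incidenceFinset _ _).2 ⟨h, Sym2.mem_mk_right u v⟩
  have hsub : (G.lineGraph.neighborFinset ⟨s(u, v), h⟩).map (Function.Embedding.subtype _) ⊆
      (G.incidenceFinset u).erase s(u, v) ∪ (G.incidenceFinset v).erase s(u, v) := by
    intro f hf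
    simp only [Finset.mem_map, SimpleGraph.mem_neighborFinset, SimpleGraph.lineGraph_adj_iff_exists,
      Function.Embedding.subtype_apply] at hf
    obtain ⟨⟨f, hfG⟩, ⟨hne, w, hw, hwf⟩, rfl⟩ := hf
    have hne' : f ≠ s(u, v) := fun h' => hne (Subtype.ext h'.symm)
    simp only [Finset.mem_union, Finset.mem_erase, SimpleGraph.mem_incidenceFinset]
    rcases Sym2.mem_iff.1 hw with rfl | rfl
    · exact Or.inl ⟨hne', hfG, hwf⟩
    · exact Or.inr ⟨hne', hfG, hwf⟩
  have hcard := (Finset.card_le_card hsub).trans (Finset.card_union_le _ _)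
  rw [Finset.card_map, SimpleGraph.card_neighborFinset_eq_degree] at hcard
  have hcu := Finset.card_erase_add_one hu
  have hcv := Finset.card_erase_add_one hv
  rw [SimpleGraph.card_incidenceFinset_eq_degree] at hcu hcv
  omega

/-- The fractions of a nonempty set lying in the parts of a partition of a superset, summed over
the parts that meet the set, give `1`. -/
theorem Finset.sum_card_inter_div_card_eq_one {α κ : Type*} [DecidableEq α] [Fintype κ]
    {C : κ → Finset α} (hdisj : ∀ i j, i ≠ j → Disjoint (C i) (C j)) {S : Finset α}
    (hS : S.Nonempty) (hSC : S ⊆ Finset.univ.biUnion C) :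
    ∑ j with (S ∩ C j).Nonempty, ((S ∩ C j).card : ℝ) / (S.card : ℝ) = 1 := by
  have hcover : Finset.univ.biUnion (fun j => S ∩ C j) = S := by
    rw [← Finset.inter_biUnion, Finset.inter_eq_left.2 hSC]
  have hcard : ∑ j, (S ∩ C j).card = S.card := by
    rw [← Finset.card_biUnion fun i _ j _ hij =>
      (hdisj i j hij).mono Finset.inter_subset_right Finset.inter_subset_right, hcover]
  have hfilter : ∑ j with (S ∩ C j).Nonempty, ((S ∩ C j).card : ℝ) / (S.card : ℝ) =
      ∑ j, ((S ∩ C j).card : ℝ) / (S.card : ℝ) := by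
    refine Finset.sum_filter_of_ne fun j _ hj => ?_
    rw [Finset.nonempty_iff_ne_empty]
    rintro h
    simp [h] at hj
  rw [hfilter, ← Finset.sum_div, ← Nat.cast_sum, hcard, div_self]
  exact_mod_cast hS.card_pos.ne'

/-- **list color space reduction.** Let `G = (V,E)` be a finite simple
graph, let `p ≥ 2` be an integer, and let `𝒞` be a finite color space partitioned into
`q` parts `𝒞₁, …, 𝒞_q` with `1 ≤ q ≤ 2p`. Suppose each edge `e ∈ E` is assigned a
nonempty finite list `L_e ⊆ 𝒞`. Then there exists an assignment `i : E → {1, …, q}` of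
a color subspace to each edge such that for every edge `e = {u,v} ∈ E`:
(a) `L_e ∩ 𝒞_{i(e)} ≠ ∅`, and (b) the number `deg'(e)` of neighboring edges `f` with
`i(f) = i(e)` satisfies
`deg'(e) ≤ 24 · H_q · log₂ p · (|L_e ∩ 𝒞_{i(e)}| / |L_e|) · deg(e)`,
where `deg(e) = deg(u) + deg(v) - 2` and `H_q = ∑_{i=1}^q 1/i`. -/
theorem list_color_space_reduction {V α : Type*} [Fintype V] [DecidableEq V]
    [DecidableEq α] (G : SimpleGraph V) [DecidableRel G.Adj]
    (p q : ℕ) (hp : 2 ≤ p) (hq1 : 1 ≤ q) (hq2 : q ≤ 2 * p)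
    (𝒞 : Finset α) (C : Fin q → Finset α)
    (hdisj : ∀ i j : Fin q, i ≠ j → Disjoint (C i) (C j))
    (hunion : Finset.univ.biUnion C = 𝒞)
    (L : Sym2 V → Finset α)
    (hL : ∀ u v : V, G.Adj u v → L s(u, v) ⊆ 𝒞 ∧ (L s(u, v)).Nonempty) :
    ∃ i : Sym2 V → Fin q, ∀ u v : V, G.Adj u v →
      (L s(u, v) ∩ C (i s(u, v))).Nonempty ∧
      (({f | f ∈ G.edgeSet ∧ f ≠ s(u, v) ∧ (u ∈ f ∨ v ∈ f) ∧ i f = i s(u, v)}.ncard : ℝ) ≤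
        24 * (∑ j ∈ Finset.Icc 1 q, (1 : ℝ) / j) * Real.logb 2 p *
          (((L s(u, v) ∩ C (i s(u, v))).card : ℝ) / ((L s(u, v)).card : ℝ)) *
          ((G.degree u : ℝ) + (G.degree v : ℝ) - 2)) := by
  classical
  have hL' : ∀ e : G.edgeSet, L e ⊆ Finset.univ.biUnion C ∧ (L e).Nonempty := by
    rintro ⟨e, he⟩
    induction e with
    | _ u v => rw [hunion]; exact hL u v he
  have hsum : ∀ e : G.edgeSet, ∑ j with (L e ∩ C j).Nonempty,
      ((L e ∩ C j).card : ℝ) / ((L e).card : ℝ) = 1 := fun e =>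
    Finset.sum_card_inter_div_card_eq_one hdisj (hL' e).2 (hL' e).1
  obtain ⟨c, hc⟩ := G.lineGraph.exists_defective_list_coloring
    (fun e => Finset.univ.filter fun j => (L e ∩ C j).Nonempty)
    (fun e => Finset.nonempty_of_sum_ne_zero (by rw [hsum e]; exact one_ne_zero))
    (fun e j => ((L e ∩ C j).card : ℝ) / ((L e).card : ℝ) * G.lineGraph.degree e)
    (fun e => by rw [← Finset.sum_mul, hsum e, one_mul])
  let i : Sym2 V → Fin q := fun e => if h : e ∈ G.edgeSet then c ⟨e, h⟩ else ⟨0, hq1⟩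
  have hi : ∀ e : G.edgeSet, i e = c e := fun e => dif_pos e.2
  refine ⟨i, fun u v huv => ?_⟩
  obtain ⟨hmem, hdeg⟩ := hc ⟨s(u, v), huv⟩
  rw [← hi ⟨s(u, v), huv⟩] at hmem hdeg
  refine ⟨(Finset.mem_filter.1 hmem).2, ?_⟩
  have hset : {f | f ∈ G.edgeSet ∧ f ≠ s(u, v) ∧ (u ∈ f ∨ v ∈ f) ∧ i f = i s(u, v)} ⊆
      (((G.lineGraph.neighborFinset ⟨s(u, v), huv⟩).filter
        (fun w => c w = i s(u, v))).map (Function.Embedding.subtype _) : Set (Sym2 V)) := by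
    rintro f ⟨hf, hne, hshare, hcol⟩
    simp only [Finset.mem_coe, Finset.mem_map, Finset.mem_filter,
      SimpleGraph.mem_neighborFinset, SimpleGraph.lineGraph_adj_iff_exists,
      Function.Embedding.subtype_apply]
    refine ⟨⟨f, hf⟩, ⟨⟨fun h => hne (congrArg Subtype.val h).symm, ?_⟩, ?_⟩, rfl⟩
    · rcases hshare with h | h
      · exact ⟨u, Sym2.mem_mk_left u v, h⟩
      · exact ⟨v, Sym2.mem_mk_right u v, h⟩
    · rw [← hi ⟨f, hf⟩]; exact hcol
  have hncard := Set.ncard_le_ncard hset (Finset.finite_toSet _)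
  rw [Set.ncard_coe_finset, Finset.card_map] at hncard
  have hdegree : (G.lineGraph.degree ⟨s(u, v), huv⟩ : ℝ) ≤
      (G.degree u : ℝ) + (G.degree v : ℝ) - 2 := by
    rw [le_sub_iff_add_le]
    exact_mod_cast G.degree_lineGraph_add_two_le huv
  have hH : (1 : ℝ) ≤ ∑ j ∈ Finset.Icc 1 q, (1 : ℝ) / j := by
    have := Finset.single_le_sum (f := fun j : ℕ => (1 : ℝ) / j) (fun j _ => by positivity)
      (Finset.mem_Icc.2 ⟨le_rfl, hq1⟩)
    simpa using this
  have hlog : (1 : ℝ) ≤ Real.logb 2 p := by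
    rw [Real.le_logb_iff_rpow_le one_lt_two (Nat.cast_pos.2 (by omega)), Real.rpow_one]
    exact_mod_cast hp
  have hconst : (1 : ℝ) ≤ 24 * (∑ j ∈ Finset.Icc 1 q, (1 : ℝ) / j) * Real.logb 2 p :=
    one_le_mul_of_one_le_of_one_le (by linarith) hlog
  let r : ℝ := ((L s(u, v) ∩ C (i s(u, v))).card : ℝ) / ((L s(u, v)).card : ℝ)
  have hr : 0 ≤ r := div_nonneg (Nat.cast_nonneg _) (Nat.cast_nonneg _)
  have hd : 0 ≤ (G.degree u : ℝ) + (G.degree v : ℝ) - 2 := (Nat.cast_nonneg _).trans hdegree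
  calc _ ≤ r * (G.lineGraph.degree ⟨s(u, v), huv⟩ : ℝ) := (Nat.cast_le.2 hncard).trans hdeg
    _ ≤ r * ((G.degree u : ℝ) + (G.degree v : ℝ) - 2) := by exact mul_le_mul_of_nonneg_left hdegree hr
    _ ≤ _ := by
      rw [mul_assoc _ (_ / _ : ℝ)]
      exact le_mul_of_one_le_left (mul_nonneg hr hd) hconst
end
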